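/- (Uniform energy-domination bound on the backbone.) Let T ⊆ {1,…,m} be a connected spanning set of edges, let L_T = Σ_{e ∈ T} w_e a_e a_eᵀ, and let ρ_T ∈ ℝ^m have entries ρ_T(e) = a_eᵀ L_T^† a_e. Let s ∈ [0,1]^m satisfy s_e = 1 for all e ∈ T, and for h ∈ ℝ^m put V(h) = Aᵀ diag(w ∘ h) A. Then for every y ∈ ℝ^n with yᵀ1 = 0, |yᵀ V(h) y| ≤ Σ_e w_e |h_e| (a_eᵀ y)² ≤ ‖w ∘ ρ_T‖₂ · ‖h‖₂ · ( yᵀ L_s y ). -/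

import Mathlib

open Matrix MeasureTheory BigOperators

noncomputable section

/-- `A` is a signed incidence matrix: each row is `e_i - e_j` for some `i ≠ j`. -/
def isIncidence (n m : ℕ) (A : Matrix (Fin m) (Fin n) ℝ) : Prop :=
  ∀ e : Fin m, ∃ i j : Fin n, i ≠ j ∧
    A e = fun k => (if k = i then (1 : ℝ) else 0) - (if k = j then (1 : ℝ) else 0)

/-- The matrix `1 1ᵀ / n`, with all entries equal to `1/n`. -/
def onesMat (n : ℕ) : Matrix (Fin n) (Fin n) ℝ := fun _ _ => (1 : ℝ) / n

/-- The switched Laplacian `L_s = Aᵀ diag(w ∘ s) A`. -/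
def Lap (n m : ℕ) (A : Matrix (Fin m) (Fin n) ℝ) (w s : Fin m → ℝ) :
    Matrix (Fin n) (Fin n) ℝ :=
  Aᵀ * Matrix.diagonal (fun e => w e * s e) * A

/-- The Moore–Penrose pseudoinverse of a connected Laplacian:
`L† = (L + 1 1ᵀ/n)⁻¹ - 1 1ᵀ/n`. -/
def Lpinv (n m : ℕ) (A : Matrix (Fin m) (Fin n) ℝ) (w s : Fin m → ℝ) :
    Matrix (Fin n) (Fin n) ℝ :=
  (Lap n m A w s + onesMat n)⁻¹ - onesMat n

/-- Connectivity, encoded as: the kernel of the Laplacian is exactly `span(1)`. -/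
def kerIsOnes (n : ℕ) (L : Matrix (Fin n) (Fin n) ℝ) : Prop :=
  ∀ y : Fin n → ℝ, L.mulVec y = 0 ↔ ∃ c : ℝ, y = fun _ => c

/-- The relaxed congestion `φ(s) = dᵀ L_s† d`. -/
def phi (n m : ℕ) (A : Matrix (Fin m) (Fin n) ℝ) (w s : Fin m → ℝ) (d : Fin n → ℝ) : ℝ :=
  d ⬝ᵥ (Lpinv n m A w s).mulVec d

theorem dotProduct_Lap_mulVec (n m : ℕ) (A : Matrix (Fin m) (Fin n) ℝ) (w s : Fin m → ℝ)
    (x y : Fin n → ℝ) :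
    x ⬝ᵥ (Lap n m A w s).mulVec y = ∑ e, w e * s e * (A e ⬝ᵥ x) * (A e ⬝ᵥ y) := by
  rw [Lap, ← Matrix.mulVec_mulVec, ← Matrix.mulVec_mulVec, Matrix.dotProduct_mulVec,
    Matrix.vecMul_transpose]
  refine Finset.sum_congr rfl fun e _ => ?_
  rw [Matrix.mulVec_diagonal]
  change (A e ⬝ᵥ x) * (w e * s e * (A e ⬝ᵥ y)) = _
  ring

theorem onesMat_mulVec (n : ℕ) (x : Fin n → ℝ) :
    (onesMat n).mulVec x = fun _ => (∑ i, x i) / n := by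
  ext k
  simp only [Matrix.mulVec, dotProduct, onesMat, ← Finset.mul_sum]
  ring

theorem dotProduct_onesMat_mulVec (n : ℕ) (x y : Fin n → ℝ) :
    x ⬝ᵥ (onesMat n).mulVec y = (∑ i, x i) * (∑ i, y i) / n := by
  rw [onesMat_mulVec]
  simp only [dotProduct, ← Finset.sum_mul]
  ring

theorem isIncidence.sum_row_eq_zero {n m : ℕ} {A : Matrix (Fin m) (Fin n) ℝ}
    (hA : isIncidence n m A) (e : Fin m) : ∑ k, A e k = 0 := by
  obtain ⟨i, j, -, h⟩ := hA e
  simp [h]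

/-- The quadratic form of a Laplacian with nonnegative weights is nonnegative, also after adding
the rank-one matrix `1 1ᵀ / n`. -/
theorem Lap_add_onesMat_form_nonneg (n m : ℕ) (A : Matrix (Fin m) (Fin n) ℝ) {w s : Fin m → ℝ}
    (hw : ∀ e, 0 ≤ w e * s e) (x : Fin n → ℝ) :
    0 ≤ x ⬝ᵥ (Lap n m A w s + onesMat n).mulVec x := by
  rw [Matrix.add_mulVec, dotProduct_add, dotProduct_Lap_mulVec, dotProduct_onesMat_mulVec]
  refine add_nonneg (Finset.sum_nonneg fun e _ => ?_)
    (div_nonneg (mul_self_nonneg _) n.cast_nonneg)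
  rw [mul_assoc]
  exact mul_nonneg (hw e) (mul_self_nonneg _)

theorem isUnit_Lap_add_onesMat {n m : ℕ} (hn : 0 < n) (A : Matrix (Fin m) (Fin n) ℝ)
    {w s : Fin m → ℝ} (hw : ∀ e, 0 ≤ w e * s e) (hL : kerIsOnes n (Lap n m A w s)) :
    IsUnit (Lap n m A w s + onesMat n) := by
  have hn' : (0 : ℝ) < n := by exact_mod_cast hn
  rw [← Matrix.mulVec_injective_iff_isUnit]
  refine (injective_iff_map_eq_zero (Matrix.mulVecLin (Lap n m A w s + onesMat n))).2 ?_
  intro x hx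
  rw [Matrix.mulVecLin_apply] at hx
  have hform : x ⬝ᵥ (Lap n m A w s + onesMat n).mulVec x = 0 := by
    rw [hx, dotProduct_zero]
  rw [Matrix.add_mulVec, dotProduct_add, dotProduct_Lap_mulVec,
    dotProduct_onesMat_mulVec] at hform
  have hLap : 0 ≤ ∑ e, w e * s e * (A e ⬝ᵥ x) * (A e ⬝ᵥ x) :=
    Finset.sum_nonneg fun e _ => by
      rw [mul_assoc]
      exact mul_nonneg (hw e) (mul_self_nonneg _)
  have hsum : ∑ i, x i = 0 := by
    have hle : (∑ i, x i) * (∑ i, x i) / n ≤ 0 := by linarith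
    rw [div_le_iff₀ hn', zero_mul] at hle
    exact mul_self_eq_zero.1 (le_antisymm hle (mul_self_nonneg _))
  have hker : (Lap n m A w s).mulVec x = 0 := by
    rw [Matrix.add_mulVec, onesMat_mulVec, hsum] at hx
    simpa [← Pi.zero_def] using hx
  obtain ⟨c, rfl⟩ := (hL x).1 hker
  have hc : c = 0 := by simpa [hn.ne'] using hsum
  ext
  simp [hc]

/-- For a connected Laplacian `L` and `a, y` orthogonal to the all-ones vector,
`(aᵀ y)² ≤ (aᵀ L† a) (yᵀ L y)`. -/
theorem sq_dotProduct_le_Lpinv_mul_Lap {n m : ℕ} (hn : 0 < n) (A : Matrix (Fin m) (Fin n) ℝ)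
    {w s : Fin m → ℝ} (hw : ∀ e, 0 ≤ w e * s e) (hL : kerIsOnes n (Lap n m A w s))
    {a y : Fin n → ℝ} (ha : ∑ i, a i = 0) (hy : ∑ i, y i = 0) :
    (a ⬝ᵥ y) ^ 2 ≤
      (a ⬝ᵥ (Lpinv n m A w s).mulVec a) * (y ⬝ᵥ (Lap n m A w s).mulVec y) := by
  have hunit := isUnit_Lap_add_onesMat hn A hw hL
  have hnonneg := Lap_add_onesMat_form_nonneg n m A hw
  have hpinv : a ⬝ᵥ (Lpinv n m A w s).mulVec a
      = a ⬝ᵥ ((Lap n m A w s + onesMat n)⁻¹).mulVec a := by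
    rw [Lpinv, Matrix.sub_mulVec, dotProduct_sub, dotProduct_onesMat_mulVec, ha]
    simp
  have hyy : y ⬝ᵥ (Lap n m A w s).mulVec y
      = y ⬝ᵥ (Lap n m A w s + onesMat n).mulVec y := by
    rw [Matrix.add_mulVec, dotProduct_add, dotProduct_onesMat_mulVec, hy]
    simp
  have hsymm : ∀ u v : Fin n → ℝ, u ⬝ᵥ (Lap n m A w s + onesMat n).mulVec v
      = v ⬝ᵥ (Lap n m A w s + onesMat n).mulVec u := by
    intro u v
    simp only [Matrix.add_mulVec, dotProduct_add, dotProduct_Lap_mulVec,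
      dotProduct_onesMat_mulVec]
    congr 1
    · exact Finset.sum_congr rfl fun e _ => by ring
    · ring
  rw [hpinv, hyy]
  set M := Lap n m A w s + onesMat n
  set u := M⁻¹.mulVec a with hu
  have hMu : M.mulVec u = a := by
    rw [hu, Matrix.mulVec_mulVec,
      Matrix.mul_nonsing_inv _ ((Matrix.isUnit_iff_isUnit_det _).1 hunit), Matrix.one_mulVec]
  have hdisc := discrim_le_zero (a := y ⬝ᵥ M.mulVec y) (b := 2 * (a ⬝ᵥ y)) (c := a ⬝ᵥ u)
    fun t => by
      have ht := hnonneg (u + t • y)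
      rw [Matrix.mulVec_add, Matrix.mulVec_smul, add_dotProduct, dotProduct_add, dotProduct_add,
        dotProduct_smul, smul_dotProduct, smul_dotProduct, dotProduct_smul, hsymm u y, hMu,
        dotProduct_comm u a, dotProduct_comm y a] at ht
      simp only [smul_eq_mul] at ht
      linarith
  rw [discrim] at hdisc
  linarith

theorem abs_Lap_form_le (n m : ℕ) (A : Matrix (Fin m) (Fin n) ℝ) {w : Fin m → ℝ}
    (hw : ∀ e, 0 ≤ w e) (h : Fin m → ℝ) (y : Fin n → ℝ) :
    |y ⬝ᵥ (Lap n m A w h).mulVec y| ≤ ∑ e, w e * |h e| * (A e ⬝ᵥ y) ^ 2 := by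
  rw [dotProduct_Lap_mulVec]
  refine (Finset.abs_sum_le_sum_abs _ _).trans_eq (Finset.sum_congr rfl fun e _ => ?_)
  rw [mul_assoc, ← sq, abs_mul, abs_mul, abs_of_nonneg (hw e), abs_sq]

theorem Lap_form_mono (n m : ℕ) (A : Matrix (Fin m) (Fin n) ℝ) {w s t : Fin m → ℝ}
    (hw : ∀ e, 0 ≤ w e) (hst : ∀ e, s e ≤ t e) (y : Fin n → ℝ) :
    y ⬝ᵥ (Lap n m A w s).mulVec y ≤ y ⬝ᵥ (Lap n m A w t).mulVec y := by
  simp only [dotProduct_Lap_mulVec]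
  refine Finset.sum_le_sum fun e _ => ?_
  rw [mul_assoc, mul_assoc _ (A e ⬝ᵥ y)]
  exact mul_le_mul_of_nonneg_right (mul_le_mul_of_nonneg_left (hst e) (hw e)) (mul_self_nonneg _)

/-- Uniform energy-domination bound on the backbone.
With `T` a connected spanning edge set, `ρ_T(e) = a_eᵀ L_T† a_e`, and
`s ∈ [0,1]^m` equal to `1` on `T`, for every `h ∈ ℝ^m` and every `y ⊥ 1`:
`|yᵀ V(h) y| ≤ Σ_e w_e |h_e| (a_eᵀ y)² ≤ ‖w∘ρ_T‖₂ ‖h‖₂ (yᵀ L_s y)`,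
where `V(h) = Aᵀ diag(w∘h) A`. -/
theorem backbone_energy_domination
    (n m : ℕ) (hn : 2 ≤ n) (hm : 1 ≤ m)
    (A : Matrix (Fin m) (Fin n) ℝ) (hA : isIncidence n m A)
    (w : Fin m → ℝ) (hw : ∀ e, 0 < w e)
    (T : Finset (Fin m))
    (hTconn : kerIsOnes n (Lap n m A w (fun e => if e ∈ T then 1 else 0)))
    (s : Fin m → ℝ) (hs : ∀ e, 0 ≤ s e ∧ s e ≤ 1) (hsT : ∀ e ∈ T, s e = 1)
    (h : Fin m → ℝ) (y : Fin n → ℝ) (hy : ∑ i, y i = 0) :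
    |y ⬝ᵥ (Lap n m A w h).mulVec y| ≤ ∑ e, w e * |h e| * (A e ⬝ᵥ y) ^ 2 ∧
    ∑ e, w e * |h e| * (A e ⬝ᵥ y) ^ 2 ≤
      Real.sqrt (∑ e, (w e *
          (A e ⬝ᵥ (Lpinv n m A w (fun e => if e ∈ T then 1 else 0)).mulVec (A e))) ^ 2) *
        Real.sqrt (∑ e, (h e) ^ 2) * (y ⬝ᵥ (Lap n m A w s).mulVec y) := by
  refine ⟨abs_Lap_form_le n m A (fun e => (hw e).le) h y, ?_⟩
  set t : Fin m → ℝ := fun e => if e ∈ T then 1 else 0 with ht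
  have hwt : ∀ e, 0 ≤ w e * t e := fun e =>
    mul_nonneg (hw e).le (by simp only [ht]; split_ifs <;> norm_num)
  have hts : ∀ e, t e ≤ s e := fun e => by
    simp only [ht]
    split_ifs with he
    · exact (hsT e he).ge
    · exact (hs e).1
  set ρ : Fin m → ℝ := fun e => A e ⬝ᵥ (Lpinv n m A w t).mulVec (A e)
  have hedge : ∀ e, (A e ⬝ᵥ y) ^ 2 ≤ ρ e * (y ⬝ᵥ (Lap n m A w t).mulVec y) := fun e =>
    sq_dotProduct_le_Lpinv_mul_Lap (by omega) A hwt hTconn (hA.sum_row_eq_zero e) hy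
  have hE : 0 ≤ y ⬝ᵥ (Lap n m A w t).mulVec y := by
    have := Lap_add_onesMat_form_nonneg n m A hwt y
    rwa [Matrix.add_mulVec, dotProduct_add, dotProduct_onesMat_mulVec, hy, zero_mul, zero_div,
      add_zero] at this
  have hCS : ∑ e, w e * ρ e * |h e| ≤ √(∑ e, (w e * ρ e) ^ 2) * √(∑ e, h e ^ 2) := by
    simpa only [sq_abs] using
      Real.sum_mul_le_sqrt_mul_sqrt Finset.univ (fun e => w e * ρ e) (fun e => |h e|)
  calc ∑ e, w e * |h e| * (A e ⬝ᵥ y) ^ 2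
      ≤ ∑ e, w e * |h e| * (ρ e * (y ⬝ᵥ (Lap n m A w t).mulVec y)) :=
        Finset.sum_le_sum fun e _ =>
          mul_le_mul_of_nonneg_left (hedge e) (mul_nonneg (hw e).le (abs_nonneg _))
    _ = (∑ e, w e * ρ e * |h e|) * (y ⬝ᵥ (Lap n m A w t).mulVec y) := by
        rw [Finset.sum_mul]
        exact Finset.sum_congr rfl fun e _ => by ring
    _ ≤ √(∑ e, (w e * ρ e) ^ 2) * √(∑ e, h e ^ 2) * (y ⬝ᵥ (Lap n m A w t).mulVec y) :=
        mul_le_mul_of_nonneg_right hCS hE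
    _ ≤ √(∑ e, (w e * ρ e) ^ 2) * √(∑ e, h e ^ 2) * (y ⬝ᵥ (Lap n m A w s).mulVec y) :=
        mul_le_mul_of_nonneg_left (Lap_form_mono n m A (fun e => (hw e).le) hts y) (by positivity)
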